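/- Let c > 1 be a real number. Then the function t ↦ t · arcsinh(1/sinh(log(c·t))) is strictly monotone decreasing on the interval [1, ∞). -/

import Mathlib

open Real

theorem arsinh_inv_sinh_log {x : ℝ} (hx : 1 < x) :
    arsinh (1 / sinh (log x)) = log ((x + 1) / (x - 1)) := by
  have h1 : 0 < x - 1 := by linarith
  have h2 : 0 < x + 1 := by linarith
  rw [← arsinh_sinh (log ((x + 1) / (x - 1))), sinh_log (by linarith), sinh_log (by positivity)]
  have h3 : x ^ 2 - 1 ≠ 0 := by nlinarith
  congr 1
  field_simp
  ring

theorem log_add_one_div_sub_one_lt {x : ℝ} (hx : 1 < x) :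
    log ((x + 1) / (x - 1)) < 2 * x / (x ^ 2 - 1) := by
  have h1 : 0 < x - 1 := by linarith
  have h2 : 0 < x + 1 := by linarith
  have h3 : x ^ 2 - 1 ≠ 0 := by nlinarith
  have hy : 0 < log ((x + 1) / (x - 1)) := log_pos (by rw [one_lt_div h1]; linarith)
  calc log ((x + 1) / (x - 1)) < sinh (log ((x + 1) / (x - 1))) := self_lt_sinh_iff.2 hy
    _ = 2 * x / (x ^ 2 - 1) := by
      rw [sinh_log (by positivity)]
      have h4 : x ^ 2 - 1 = (x - 1) * (x + 1) := by ring
      rw [h4]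
      field_simp
      ring

theorem hasDerivAt_mul_log_add_one_div_sub_one {x : ℝ} (hx : 1 < x) :
    HasDerivAt (fun x : ℝ => x * log ((x + 1) / (x - 1)))
      (log ((x + 1) / (x - 1)) - 2 * x / (x ^ 2 - 1)) x := by
  have h1 : x - 1 ≠ 0 := by linarith
  have h2 : x + 1 ≠ 0 := by linarith
  have h := (hasDerivAt_id' x).mul
    ((((hasDerivAt_id' x).add_const 1).div ((hasDerivAt_id' x).sub_const 1) h1).log
      (div_ne_zero h2 h1))
  refine h.congr_deriv ?_
  have h4 : x ^ 2 - 1 = (x - 1) * (x + 1) := by ring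
  simp only [Pi.div_apply]
  rw [h4]
  field_simp
  ring

theorem strictAntiOn_mul_log_add_one_div_sub_one :
    StrictAntiOn (fun x : ℝ => x * log ((x + 1) / (x - 1))) (Set.Ioi 1) := by
  refine strictAntiOn_of_deriv_neg (convex_Ioi 1) (fun x hx =>
    (hasDerivAt_mul_log_add_one_div_sub_one hx).continuousAt.continuousWithinAt) fun x hx => ?_
  rw [interior_Ioi] at hx
  rw [(hasDerivAt_mul_log_add_one_div_sub_one hx).deriv]
  exact sub_neg.2 (log_add_one_div_sub_one_lt hx)

theorem strictAntiOn_mul_arsinh_inv_sinh_log (c : ℝ) (hc : 1 < c) :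
    StrictAntiOn (fun t : ℝ => t * Real.arsinh (1 / Real.sinh (Real.log (c * t))))
      (Set.Ici 1) := by
  intro s hs t ht hst
  have hc0 : 0 < c := by linarith
  have one_lt {u : ℝ} (hu : 1 ≤ u) : 1 < c * u := one_lt_mul_of_lt_of_le hc hu
  have key := strictAntiOn_mul_log_add_one_div_sub_one (one_lt hs) (one_lt ht)
    (mul_lt_mul_of_pos_left hst hc0)
  simp only [mul_assoc, ← arsinh_inv_sinh_log (one_lt hs), ← arsinh_inv_sinh_log (one_lt ht)]
    at key
  exact lt_of_mul_lt_mul_left key hc0.le
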